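/- (Key gap lower bound under LDS at a minimizer) Suppose C together with its LMO satisfies local dual sharpness around a nonempty set M ⊆ C with constants (A, q) and radius ρ. Let x ∈ C, let p ∈ M be a minimizer of f over C, and let s ∈ argmin_{y∈C} ⟨∇f(x), y⟩ be the selected Frank–Wolfe atom. Then, writing r = ‖p − s‖, the Frank–Wolfe gap satisfies ⟨∇f(x), x − s⟩ ≥ (f(x) − f(p)) + A‖∇f(x)‖ r^q. -/

import Mathlib

open scoped RealInnerProductSpace
open Filter

/-- The gradient inequality for a convex function on a real Hilbert space. -/
lemma ConvexOn.add_inner_le_of_hasGradientAt {E : Type*} [NormedAddCommGroup E]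
    [InnerProductSpace ℝ E] [CompleteSpace E] {S : Set E} {f : E → ℝ} {g x y : E}
    (hf : ConvexOn ℝ S f) (hx : x ∈ S) (hy : y ∈ S) (hg : HasGradientAt f g x) :
    f x + ⟪g, y - x⟫ ≤ f y := by
  have hconv := hf.comp_affineMap (AffineMap.lineMap (k := ℝ) x y)
  have hderiv : HasDerivAt (f ∘ AffineMap.lineMap (k := ℝ) x y) ⟪g, y - x⟫ 0 := by
    have hg' : HasFDerivAt f (InnerProductSpace.toDual ℝ E g)
        (AffineMap.lineMap (k := ℝ) x y 0) := by
      simpa using hg.hasFDerivAt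
    simpa using hg'.comp_hasDerivAt (0 : ℝ) AffineMap.hasDerivAt_lineMap
  have hslope := hconv.le_slope_of_hasDerivAt (x := 0) (y := 1)
    (by simpa using hx) (by simpa using hy) one_pos hderiv
  simp only [slope_def_field, Function.comp_apply, AffineMap.lineMap_apply_zero,
    AffineMap.lineMap_apply_one, sub_zero, div_one] at hslope
  linarith

/-- **Key gap lower bound under LDS at a minimizer.**
If LDS holds around `M` with constants `(A,q)` and radius `ρ`, `x ∈ C`, `p ∈ M` is a
minimizer of `f` over `C`, and `s` is the selected atom for `∇f(x)`, then
`⟪∇f(x), x - s⟫ ≥ (f(x) - f(p)) + A‖∇f(x)‖ ‖p - s‖^q`. -/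
theorem lds_gap_lower_bound_at_minimizer
    {d : ℕ} {C : Set (EuclideanSpace ℝ (Fin d))}
    (hCne : C.Nonempty) (hCcomp : IsCompact C) (hCconv : Convex ℝ C)
    {f : EuclideanSpace ℝ (Fin d) → ℝ}
    {f' : EuclideanSpace ℝ (Fin d) → EuclideanSpace ℝ (Fin d)}
    (hfconv : ConvexOn ℝ Set.univ f)
    (hgrad : ∀ y, HasGradientAt f (f' y) y)
    {M : Set (EuclideanSpace ℝ (Fin d))} (hMne : M.Nonempty) (hMC : M ⊆ C)
    {lmo : EuclideanSpace ℝ (Fin d) → EuclideanSpace ℝ (Fin d)}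
    (hlmo : ∀ g, lmo g ∈ C ∧ ∀ y ∈ C, ⟪g, lmo g⟫ ≤ ⟪g, y⟫)
    {A q ρ : ℝ} (hA : 0 < A) (hq : 2 ≤ q) (hρ : 0 < ρ)
    (hLDS : ∀ y ∈ C, Metric.infDist y M < ρ →
      ∀ g : EuclideanSpace ℝ (Fin d),
        A * ‖g‖ * ‖y - lmo g‖ ^ q ≤ ⟪g, y - lmo g⟫)
    {x p s : EuclideanSpace ℝ (Fin d)}
    (hx : x ∈ C) (hpM : p ∈ M) (hpmin : ∀ y ∈ C, f p ≤ f y)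
    (hsdef : s = lmo (f' x)) :
    (f x - f p) + A * ‖f' x‖ * ‖p - s‖ ^ q ≤ ⟪f' x, x - s⟫ := by
  have hdist : Metric.infDist p M < ρ := by rwa [Metric.infDist_zero_of_mem hpM]
  have hsharp := hLDS p (hMC hpM) hdist (f' x)
  rw [← hsdef] at hsharp
  have hgap := hfconv.add_inner_le_of_hasGradientAt (Set.mem_univ x) (Set.mem_univ p) (hgrad x)
  have hsplit : ⟪f' x, x - s⟫ = ⟪f' x, p - s⟫ - ⟪f' x, p - x⟫ := by
    rw [← inner_sub_right, sub_sub_sub_cancel_left]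
  linarith
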